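/- Corollary (second sufficient condition for ℓ = 2). Suppose ℓ = 2, a 1 1 = a 2 2, and a n 1 = a (n−1) 0 + a (n+1) 2 for all n ≥ 2. Then the weighted lattice-path matrix M is totally positive, and if moreover t ≥ 1 then for every n ∈ ℕ the Toeplitz matrix 𝒯(c) of the n-th row sequence c k = M n k is totally positive. -/

import Mathlib

open Finset

/-- A multivariate polynomial with real coefficients is *nonnegative* if all of
its coefficients are nonnegative. -/
def PolyNonneg {σ : Type*} (p : MvPolynomial σ ℝ) : Prop :=
  ∀ m, 0 ≤ p.coeff m

/-- An `ℕ × ℕ` matrix with entries in `MvPolynomial σ ℝ` is *totally positive*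
if every minor (taken along strictly increasing row and column indices) is a
nonnegative polynomial. -/
def TP {σ : Type*} (A : ℕ → ℕ → MvPolynomial σ ℝ) : Prop :=
  ∀ r : ℕ, 1 ≤ r → ∀ ρ κ : Fin r → ℕ, StrictMono ρ → StrictMono κ →
    PolyNonneg (Matrix.of fun i j : Fin r => A (ρ i) (κ j)).det

/-- The weighted lattice-path matrix `M`:
`M n 0 = ∏_{i=1}^n b i`, `M n k = 0` for `k ≥ 1` and `n < t`, and
`M n k = Σ_{i=0}^{ℓ} (a n i) * M (n-t-i) (k-1) + (b n) * M (n-1) k`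
for `n ≥ t`, `k ≥ 1`, where summands with a negative first index vanish. -/
def latticeM {R : Type*} [CommRing R] (t ℓ : ℕ) (a : ℕ → ℕ → R) (b : ℕ → R) :
    ℕ → ℕ → R
  | n, 0 => ∏ i ∈ Finset.Icc 1 n, b i
  | 0, k + 1 => if t = 0 then a 0 0 * latticeM t ℓ a b 0 k else 0
  | n + 1, k + 1 =>
      if n + 1 < t then 0
      else (∑ i ∈ Finset.range (ℓ + 1),
              if t + i ≤ n + 1 then a (n + 1) i * latticeM t ℓ a b (n + 1 - t - i) k
              else 0)
        + b (n + 1) * latticeM t ℓ a b n (k + 1)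
  termination_by n k => (k, n)

/-- The Toeplitz matrix of a sequence: `𝒯(c) i j = c (i - j)` for `i ≥ j`
and `0` otherwise. -/
def toeplitz {R : Type*} [CommRing R] (c : ℕ → R) : ℕ → ℕ → R :=
  fun i j => if j ≤ i then c (i - j) else 0

namespace PolyNonneg

variable {σ : Type*} {p q : MvPolynomial σ ℝ}

lemma zero : PolyNonneg (0 : MvPolynomial σ ℝ) := fun m => by simp

lemma one : PolyNonneg (1 : MvPolynomial σ ℝ) := fun m => by
  classical
  rw [MvPolynomial.coeff_one]
  split_ifs <;> norm_num

lemma add (hp : PolyNonneg p) (hq : PolyNonneg q) : PolyNonneg (p + q) := fun m => by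
  rw [MvPolynomial.coeff_add]
  exact add_nonneg (hp m) (hq m)

lemma mul (hp : PolyNonneg p) (hq : PolyNonneg q) : PolyNonneg (p * q) := fun m => by
  classical
  rw [MvPolynomial.coeff_mul]
  exact Finset.sum_nonneg fun x _ => mul_nonneg (hp _) (hq _)

lemma sum {ι : Type*} {s : Finset ι} {f : ι → MvPolynomial σ ℝ}
    (h : ∀ i ∈ s, PolyNonneg (f i)) : PolyNonneg (∑ i ∈ s, f i) :=
  Finset.sum_induction f PolyNonneg (fun _ _ => add) zero h

lemma prod {ι : Type*} {s : Finset ι} {f : ι → MvPolynomial σ ℝ}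
    (h : ∀ i ∈ s, PolyNonneg (f i)) : PolyNonneg (∏ i ∈ s, f i) :=
  Finset.prod_induction f PolyNonneg (fun _ _ => mul) one h

lemma ite {P : Prop} [Decidable P] (hp : PolyNonneg p) (hq : PolyNonneg q) :
    PolyNonneg (if P then p else q) := by
  split_ifs <;> assumption

end PolyNonneg

/-- All maximal minors of a matrix with rows indexed by `ℕ` and `r` columns are nonnegative. -/
def MaxMinorsNonneg {σ : Type*} {r : ℕ} (X : ℕ → Fin r → MvPolynomial σ ℝ) : Prop :=
  ∀ ρ : Fin r → ℕ, StrictMono ρ → PolyNonneg (Matrix.of fun i => X (ρ i)).det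

namespace MaxMinorsNonneg

variable {σ : Type*} {r : ℕ} {X Y : ℕ → Fin r → MvPolynomial σ ℝ}

lemma det_nonneg_of_monotone (hX : MaxMinorsNonneg X) {ρ : Fin r → ℕ} (hρ : Monotone ρ) :
    PolyNonneg (Matrix.of fun i => X (ρ i)).det := by
  by_cases hinj : Function.Injective ρ
  · exact hX ρ (hρ.strictMono_of_injective hinj)
  · simp only [Function.Injective, not_forall] at hinj
    obtain ⟨i, j, hij, hne⟩ := hinj
    rw [Matrix.det_zero_of_row_eq hne (by ext; simp [hij])]
    exact PolyNonneg.zero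

/-- Left multiplication by a matrix whose `n`-th row is supported on the columns `lo n`, `hi n`
preserves nonnegativity of maximal minors when these supports are weakly increasing. -/
lemma combine_two (hX : MaxMinorsNonneg X) (p q : ℕ → MvPolynomial σ ℝ) (hi lo : ℕ → ℕ)
    (hp : ∀ n, PolyNonneg (p n)) (hq : ∀ n, PolyNonneg (q n))
    (hlo : ∀ n, lo n ≤ hi n) (hstep : ∀ n, hi n ≤ lo (n + 1))
    (hY : ∀ n, Y n = p n • X (hi n) + q n • X (lo n)) : MaxMinorsNonneg Y := by
  intro ρ hρ
  have hmono : Monotone lo := monotone_nat_of_le_succ fun n => (hlo n).trans (hstep n)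
  have hlt : ∀ m n, m < n → hi m ≤ lo n := fun m n h => (hstep m).trans (hmono h)
  have hexp : (Matrix.of fun i => Y (ρ i)).det = ∑ s : Finset (Fin r),
      (∏ i, if i ∈ s then p (ρ i) else q (ρ i)) *
        (Matrix.of fun i => X (if i ∈ s then hi (ρ i) else lo (ρ i))).det := by
    have h := (Matrix.detRowAlternating (n := Fin r) (R := MvPolynomial σ ℝ)).map_add_univ
      (fun i => p (ρ i) • X (hi (ρ i))) (fun i => q (ρ i) • X (lo (ρ i)))
    have h0 : (Matrix.of fun i => Y (ρ i)) =
        (fun i => p (ρ i) • X (hi (ρ i))) + (fun i => q (ρ i) • X (lo (ρ i))) := by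
      ext i j
      simp [hY]
    rw [h0]
    refine h.trans (Finset.sum_congr rfl fun s _ => ?_)
    rw [← Matrix.det_mul_column]
    refine congrArg Matrix.det ?_
    ext i j
    by_cases his : i ∈ s <;> simp [his, Finset.piecewise]
  rw [hexp]
  refine PolyNonneg.sum fun s _ => (PolyNonneg.prod fun i _ => (hp _).ite (hq _)).mul
    (hX.det_nonneg_of_monotone fun i j hij => ?_)
  rcases hij.eq_or_lt with rfl | hij
  · rfl
  · have := hlt _ _ (hρ hij)
    have := hlo (ρ i)
    have := hlo (ρ j)
    split_ifs <;> omega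

/-- Left multiplication by a lower bidiagonal matrix with unit diagonal. -/
lemma add_smul_pred (hX : MaxMinorsNonneg X) (c : ℕ → MvPolynomial σ ℝ)
    (hc : ∀ n, PolyNonneg (c n)) (hY : ∀ n, Y n = X n + c n • X (n - 1)) :
    MaxMinorsNonneg Y :=
  hX.combine_two (fun _ => 1) c id (· - 1) (fun _ => PolyNonneg.one) hc
    (fun n => Nat.sub_le n 1) (fun _ => le_rfl) (fun n => by simp [hY])

/-- Left multiplication by the inverse of a lower bidiagonal matrix with unit diagonal and
nonpositive subdiagonal. -/
lemma of_recurrence (hX : MaxMinorsNonneg X) (c : ℕ → MvPolynomial σ ℝ)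
    (hc : ∀ n, PolyNonneg (c n)) (h0 : Y 0 = X 0)
    (hY : ∀ n, Y (n + 1) = X (n + 1) + c (n + 1) • Y n) : MaxMinorsNonneg Y := by
  have hstage : ∀ s, MaxMinorsNonneg fun n => if n ≤ s then Y n else X n := by
    intro s
    induction s with
    | zero =>
      convert hX using 2 with n
      split_ifs with h
      · obtain rfl : n = 0 := by omega
        exact h0
      · rfl
    | succ s ih =>
      refine ih.add_smul_pred (fun n => if n = s + 1 then c n else 0)
        (fun n => (hc n).ite PolyNonneg.zero) fun n => ?_
      rcases lt_trichotomy n (s + 1) with h | rfl | h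
      · simp [h.le, Nat.lt_succ_iff.mp h, h.ne]
      · simp [hY]
      · have h1 : ¬ n ≤ s + 1 := by omega
        have h2 : ¬ n ≤ s := by omega
        simp [h1, h2, h.ne']
  intro ρ hρ
  convert hstage (∑ i, ρ i) ρ hρ using 4 with i
  exact (if_pos (Finset.single_le_sum (f := ρ) (fun _ _ => Nat.zero_le _)
    (Finset.mem_univ i))).symm

/-- The columns of the identity matrix selected by a strictly increasing map. -/
lemma identity {κ : Fin r → ℕ} (hκ : StrictMono κ) :
    MaxMinorsNonneg (σ := σ) fun n j => if n = κ j then 1 else 0 := by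
  intro ρ hρ
  by_cases hsub : ∀ i, ρ i ∈ Set.range κ
  · have hrange : Set.range ρ = Set.range κ := by
      refine Set.eq_of_subset_of_ncard_le (Set.range_subset_iff.mpr hsub) ?_ (Set.finite_range κ)
      rw [← Set.image_univ, ← Set.image_univ, Set.ncard_image_of_injective _ hκ.injective,
        Set.ncard_image_of_injective _ hρ.injective]
    obtain rfl := (hρ.range_inj hκ).mp hrange
    convert PolyNonneg.one (σ := σ)
    rw [← Matrix.det_one (n := Fin r)]
    congr 1
    ext1 i j
    simp [Matrix.one_apply, hρ.injective.eq_iff]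
  · push Not at hsub
    obtain ⟨i, hi⟩ := hsub
    rw [Matrix.det_eq_zero_of_row_eq_zero i]
    · exact PolyNonneg.zero
    · intro j
      have : ρ i ≠ κ j := fun h => hi ⟨j, h.symm⟩
      simp [this]

end MaxMinorsNonneg

section LatticePaths

variable {R : Type*} [CommRing R] (t : ℕ) (a : ℕ → ℕ → R) (b : ℕ → R)

/-- Weight of the lattice paths of total height `q - d` ending in abscissa `n`
(zero if `q < d`), regarded as a sequence in `q`. -/
def shiftedM (n d q : ℕ) : R :=
  if d ≤ q then latticeM t 2 a b n (q - d) else 0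

lemma shiftedM_zero (d q : ℕ) :
    shiftedM t a b 0 d q =
      (if d = q then 1 else 0) + (if t = 0 then a 0 0 else 0) * shiftedM t a b 0 (d + 1) q := by
  unfold shiftedM
  rcases lt_trichotomy d q with h | rfl | h
  · obtain ⟨k, rfl⟩ := Nat.exists_eq_add_of_lt h
    have h1 : d + k + 1 - d = k + 1 := by omega
    have h2 : d + k + 1 - (d + 1) = k := by omega
    have h3 : d ≤ d + k + 1 := by omega
    have h4 : d ≠ d + k + 1 := by omega
    rw [h1, h2, latticeM]
    simp [h3, h4]
  · simp [latticeM]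
  · have h1 : ¬ d ≤ q := by omega
    have h2 : ¬ d + 1 ≤ q := by omega
    simp [h1, h2, h.ne']

lemma shiftedM_succ (n d q : ℕ) :
    shiftedM t a b (n + 1) d q =
      (∑ i ∈ range 3, if t + i ≤ n + 1 then
        a (n + 1) i * shiftedM t a b (n + 1 - t - i) (d + 1) q else 0) +
      b (n + 1) * shiftedM t a b n d q := by
  unfold shiftedM
  rcases lt_trichotomy d q with h | rfl | h
  · obtain ⟨k, rfl⟩ := Nat.exists_eq_add_of_lt h
    have h1 : d + k + 1 - d = k + 1 := by omega
    have h2 : d + k + 1 - (d + 1) = k := by omega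
    have h3 : d ≤ d + k + 1 := by omega
    have h4 : d + 1 ≤ d + k + 1 := by omega
    rw [h1, h2, latticeM]
    simp only [h3, h4, if_true]
    split_ifs with hn
    · have hM : latticeM t 2 a b n (k + 1) = 0 := by
        cases n with
        | zero => rw [latticeM, if_neg (by omega)]
        | succ n => rw [latticeM, if_pos (by omega)]
      rw [hM, Finset.sum_eq_zero, mul_zero, add_zero]
      intro i _
      rw [if_neg (by omega)]
    · rfl
  · simp [latticeM, Finset.prod_Icc_succ_top, mul_comm]
  · have h1 : ¬ d ≤ q := by omega
    have h2 : ¬ d + 1 ≤ q := by omega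
    simp [h1, h2]

/-- End points along a staircase: unit rows up to height `d`, then the row of
height `d` for abscissae `0, …, N`, then the column of abscissa `N`. -/
def staircase (N d p q : ℕ) : R :=
  if p < d then (if p = q then 1 else 0)
  else if p ≤ d + N then shiftedM t a b (p - d) d q
  else shiftedM t a b N (p - N) q

lemma staircase_of_lt {N d p : ℕ} (h : p < d) (q : ℕ) :
    staircase t a b N d p q = if p = q then 1 else 0 := if_pos h

lemma staircase_add {N d m : ℕ} (h : m ≤ N) (q : ℕ) :
    staircase t a b N d (d + m) q = shiftedM t a b m d q := by
  simp [staircase, h]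

lemma staircase_of_le {N d p : ℕ} (h : d + N ≤ p) (q : ℕ) :
    staircase t a b N d p q = shiftedM t a b N (p - N) q := by
  unfold staircase
  rw [if_neg (by omega)]
  split_ifs with h1
  · obtain rfl : p = d + N := by omega
    simp
  · rfl

end LatticePaths

section TotalPositivity

variable {σ : Type*} {t : ℕ} {a : ℕ → ℕ → MvPolynomial σ ℝ} {b : ℕ → MvPolynomial σ ℝ}

/-- The three-term sum of the recurrence splits into two consecutive two-term sums, i.e. the
banded weight matrix is a product of two bidiagonal matrices. -/
lemma sum_weights_eq (h1 : a 1 1 = a 2 2)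
    (h2 : ∀ n, 2 ≤ n → a n 1 = a (n - 1) 0 + a (n + 1) 2)
    (G : ℕ → MvPolynomial σ ℝ) (n : ℕ) :
    (∑ i ∈ range 3, if t + i ≤ n + 1 then a (n + 1) i * G (n + 1 - t - i) else 0) =
      ((if t ≤ n + 1 then a (n + 1) 0 else 0) * G (n + 1 - t) +
        (if t + 1 ≤ n + 1 then a (n + 2) 2 else 0) * G (n + 1 - t - 1)) +
      (if 1 ≤ n then 1 else 0) * ((if t ≤ n then a n 0 else 0) * G (n - t) +
        (if t + 1 ≤ n then a (n + 1) 2 else 0) * G (n - t - 1)) := by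
  simp only [Finset.sum_range_succ, Finset.sum_range_zero, zero_add, add_zero, Nat.sub_zero]
  have e1 : n + 1 - t - 1 = n - t := by omega
  have e2 : n + 1 - t - 2 = n - t - 1 := by omega
  rw [e1, e2]
  rcases Nat.eq_zero_or_pos n with rfl | hn
  · have h3 : ¬ t + 2 ≤ 1 := by omega
    simp [h3, h1]
  · have h := h2 (n + 1) (by omega)
    rw [Nat.add_sub_cancel] at h
    simp only [h, Nat.add_le_add_iff_right, show t + 2 ≤ n + 1 ↔ t + 1 ≤ n by omega,
      if_pos (show 1 ≤ n from hn)]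
    split_ifs <;> ring

/-- Passing from level `d + 1` of the staircase to level `d` is a composition
of three bidiagonal operations. -/
lemma staircase_step (ha : ∀ n i, i ≤ 2 → PolyNonneg (a n i)) (hb : ∀ n, PolyNonneg (b n))
    (h1 : a 1 1 = a 2 2) (h2 : ∀ n, 2 ≤ n → a n 1 = a (n - 1) 0 + a (n + 1) 2)
    {r : ℕ} (κ : Fin r → ℕ) (N d : ℕ)
    (h : MaxMinorsNonneg fun p j => staircase t a b N (d + 1) p (κ j)) :
    MaxMinorsNonneg fun p j => staircase t a b N d p (κ j) := by
  set W : ℕ → Fin r → MvPolynomial σ ℝ := fun p j => staircase t a b N (d + 1) p (κ j) with hW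
  let G : ℕ → ℕ → Fin r → MvPolynomial σ ℝ := fun m e j => shiftedM t a b m e (κ j)
  let u : ℕ → MvPolynomial σ ℝ := fun p =>
    if p < d then 0 else if p = d then (if t = 0 then a 0 0 else 0)
    else if p ≤ d + N then (if t ≤ p - d then a (p - d) 0 else 0) else 0
  let v : ℕ → MvPolynomial σ ℝ := fun p =>
    if p ≤ d then 1 else if p ≤ d + N then (if t + 1 ≤ p - d then a (p - d + 1) 2 else 0) else 1
  let hi : ℕ → ℕ := fun p =>
    if p < d then p else if p ≤ d + N then d + 1 + (p - d - t) else p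
  let lo : ℕ → ℕ := fun p =>
    if p ≤ d then p else if p ≤ d + N then d + 1 + (p - d - t - 1) else p
  let X : ℕ → Fin r → MvPolynomial σ ℝ := fun p => u p • W (hi p) + v p • W (lo p)
  have hX : MaxMinorsNonneg X := by
    refine h.combine_two u v hi lo (fun p => ?_) (fun p => ?_) (fun p => ?_) (fun p => ?_)
      fun p => rfl
    · exact PolyNonneg.zero.ite (((ha _ _ (by omega)).ite PolyNonneg.zero).ite
        (((ha _ _ (by omega)).ite PolyNonneg.zero).ite PolyNonneg.zero))
    · exact PolyNonneg.one.ite (((ha _ _ (by omega)).ite PolyNonneg.zero).ite PolyNonneg.one)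
    · simp only [hi, lo]
      split_ifs <;> omega
    · simp only [hi, lo]
      split_ifs <;> omega
  let Z : ℕ → Fin r → MvPolynomial σ ℝ := fun p =>
    X p + (if d + 2 ≤ p ∧ p ≤ d + N then (1 : MvPolynomial σ ℝ) else 0) • X (p - 1)
  have hZ : MaxMinorsNonneg Z :=
    hX.add_smul_pred _ (fun p => PolyNonneg.one.ite PolyNonneg.zero) fun p => rfl
  have hX_lt : ∀ p, p < d → X p = W p := fun p hp => by
    simp [X, u, v, lo, hp, hp.le]
  have hX_eq : X d = W d + (if t = 0 then a 0 0 else 0) • W (d + 1) := by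
    simp [X, u, v, lo, hi, add_comm]
  have hW_G : ∀ m, m ≤ N → W (d + 1 + m) = G m (d + 1) := fun m hm =>
    funext fun j => staircase_add t a b hm _
  have hX_mid : ∀ m, 1 ≤ m → m ≤ N → X (d + m) =
      (if t ≤ m then a m 0 else 0) • G (m - t) (d + 1) +
        (if t + 1 ≤ m then a (m + 1) 2 else 0) • G (m - t - 1) (d + 1) := fun m hm hmN => by
    rw [← hW_G _ (by omega), ← hW_G _ (by omega)]
    have hm0 : m ≠ 0 := by omega
    simp [X, u, v, lo, hi, hmN, hm0]
  have hX_gt : ∀ p, d + N < p → X p = W p := fun p hp => by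
    have e1 : ¬ p < d := by omega
    have e2 : ¬ p ≤ d := by omega
    have e3 : p ≠ d := by omega
    have e4 : ¬ p ≤ d + N := by omega
    simp [X, u, v, lo, e1, e2, e3, e4]
  have hZ_le : ∀ p, p ≤ d + 1 ∨ d + N < p → Z p = X p := fun p hp => by
    have e : ¬ (d + 2 ≤ p ∧ p ≤ d + N) := by omega
    simp [Z, e]
  have hlow : ∀ p, p < d → (fun j => staircase t a b N d p (κ j)) = Z p := fun p hp => by
    rw [hZ_le p (by omega), hX_lt p hp]
    funext j
    rw [staircase_of_lt t a b hp, hW]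
    exact (staircase_of_lt t a b (by omega) _).symm
  have hmid : (fun j => staircase t a b N d d (κ j)) = Z d := by
    rw [hZ_le d (by omega), hX_eq]
    funext j
    have e := staircase_add t a b (N := N) (d := d) (Nat.zero_le N) (κ j)
    rw [Nat.add_zero] at e
    have eW := congrFun (hW_G 0 (Nat.zero_le N)) j
    rw [Nat.add_zero] at eW
    rw [e, shiftedM_zero, Pi.add_apply, Pi.smul_apply, smul_eq_mul, eW, hW]
    dsimp only
    rw [staircase_of_lt t a b (Nat.lt_succ_self d)]
  refine hZ.of_recurrence
    (fun p => if d + 1 ≤ p ∧ p ≤ d + N then b (p - d) else 0)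
    (fun p => (hb _).ite PolyNonneg.zero) ?_ fun p => ?_
  · rcases Nat.eq_zero_or_pos d with rfl | hd
    · exact hmid
    · exact hlow 0 hd
  · rcases lt_or_ge p d with hp | hp
    · rw [if_neg (by omega), zero_smul, add_zero]
      rcases eq_or_ne (p + 1) d with rfl | hne
      · exact hmid
      · exact hlow _ (by omega)
    · obtain ⟨n, rfl⟩ := Nat.exists_eq_add_of_le hp
      rcases lt_or_ge n N with hn | hn
      · rw [if_pos (by omega)]
        have hZ_eq : Z (d + n + 1) = X (d + (n + 1)) +
            (if 1 ≤ n then (1 : MvPolynomial σ ℝ) else 0) • X (d + n) := by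
          have e : (d + 2 ≤ d + n + 1 ∧ d + n + 1 ≤ d + N) ↔ 1 ≤ n := by omega
          simp only [Z, e]
          rfl
        have hXn : (if 1 ≤ n then (1 : MvPolynomial σ ℝ) else 0) • X (d + n) =
            (if 1 ≤ n then (1 : MvPolynomial σ ℝ) else 0) •
              ((if t ≤ n then a n 0 else 0) • G (n - t) (d + 1) +
                (if t + 1 ≤ n then a (n + 1) 2 else 0) • G (n - t - 1) (d + 1)) := by
          by_cases h0 : 1 ≤ n
          · rw [hX_mid n h0 hn.le]
          · simp only [if_neg h0, zero_smul]
        rw [hZ_eq, hXn, hX_mid (n + 1) (by omega) hn]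
        funext j
        have e1 := staircase_add t a b (N := N) (d := d) (m := n + 1) hn (κ j)
        have e2 := staircase_add t a b (N := N) (d := d) hn.le (κ j)
        have e3 : d + n + 1 - d = n + 1 := by omega
        simp only [Pi.add_apply, Pi.smul_apply, smul_eq_mul]
        rw [add_assoc d n 1, e1, e2, shiftedM_succ, ← add_assoc d n 1, e3,
          sum_weights_eq h1 h2 (fun m => shiftedM t a b m (d + 1) (κ j))]
      · rw [if_neg (by omega), zero_smul, add_zero, hZ_le _ (by omega), hX_gt _ (by omega)]
        funext j
        rw [hW]
        dsimp only
        rw [staircase_of_le t a b (by omega), staircase_of_le t a b (by omega)]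

lemma maxMinorsNonneg_staircase (ha : ∀ n i, i ≤ 2 → PolyNonneg (a n i))
    (hb : ∀ n, PolyNonneg (b n))
    (h1 : a 1 1 = a 2 2) (h2 : ∀ n, 2 ≤ n → a n 1 = a (n - 1) 0 + a (n + 1) 2)
    {r : ℕ} {κ : Fin r → ℕ} (hκ : StrictMono κ) (N : ℕ) :
    MaxMinorsNonneg fun p j => staircase t a b N 0 p (κ j) := by
  have hκ_lt : ∀ j, κ j < (∑ i, κ i) + 1 := fun j => Nat.lt_succ_of_le
    (Finset.single_le_sum (f := κ) (fun _ _ => Nat.zero_le _) (Finset.mem_univ j))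
  have hbase : MaxMinorsNonneg fun p j => staircase t a b N ((∑ i, κ i) + 1) p (κ j) := by
    convert MaxMinorsNonneg.identity (σ := σ) hκ using 3 with p j
    have hj := hκ_lt j
    unfold staircase shiftedM
    split_ifs <;> first | rfl | omega
  generalize (∑ i, κ i) + 1 = d at hbase
  induction d with
  | zero => exact hbase
  | succ d ih => exact ih (staircase_step ha hb h1 h2 κ N d hbase)

end TotalPositivity

/-- **Corollary (second sufficient condition for `ℓ = 2`).**  Suppose `ℓ = 2`,
`a 1 1 = a 2 2`, and `a n 1 = a (n-1) 0 + a (n+1) 2` for all `n ≥ 2`.  Then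
the weighted lattice-path matrix `M` is totally positive, and if moreover
`t ≥ 1` then every row of `M` has a totally positive Toeplitz matrix. -/
theorem latticeM_totallyPositive_of_cond_two
    {σ : Type*} (t : ℕ) (a : ℕ → ℕ → MvPolynomial σ ℝ) (b : ℕ → MvPolynomial σ ℝ)
    (ha : ∀ n i, i ≤ 2 → PolyNonneg (a n i)) (hb : ∀ n, PolyNonneg (b n))
    (h1 : a 1 1 = a 2 2)
    (h2 : ∀ n, 2 ≤ n → a n 1 = a (n - 1) 0 + a (n + 1) 2) :
    TP (latticeM t 2 a b) ∧
      (1 ≤ t → ∀ n, TP (toeplitz fun k => latticeM t 2 a b n k)) := by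
  refine ⟨fun r _ ρ κ hρ hκ => ?_, fun _ n r _ ρ κ hρ hκ => ?_⟩
  · convert maxMinorsNonneg_staircase (t := t) ha hb h1 h2 hκ (∑ i, ρ i) ρ hρ using 4 with i
    funext j
    have hi : ρ i ≤ ∑ i, ρ i :=
      Finset.single_le_sum (f := ρ) (fun _ _ => Nat.zero_le _) (Finset.mem_univ i)
    have e := staircase_add t a b (d := 0) hi (κ j)
    rw [Nat.zero_add] at e
    simp [e, shiftedM]
  · rw [← Matrix.det_transpose]
    convert maxMinorsNonneg_staircase (t := t) ha hb h1 h2 hρ n (fun i => n + κ i)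
      (fun i j hij => Nat.add_lt_add_left (hκ hij) n) using 2
    ext1 i j
    have e := staircase_of_le t a b (N := n) (d := 0) (p := n + κ i) (by omega) (ρ j)
    simp [e, toeplitz, shiftedM]
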